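/- Let M₁ = {m₁, m₂, …} be a set of positive integers, let d be a positive integer, and let M₂ = {d·m₁, d·m₂, …} = d·M₁. Then μ(M₁) = μ(M₂). -/

import Mathlib

open Filter Set Pointwise

/-- `countBelow S x` is the number of elements `n ∈ S` with `n ≤ x`. -/
noncomputable def countBelow (S : Set ℕ) (x : ℕ) : ℕ := (S ∩ Set.Iic x).ncard

/-- The upper asymptotic density `δ̄(S) = limsup_{x→∞} S(x)/x` of a set `S ⊆ ℕ`. -/
noncomputable def upperDensity (S : Set ℕ) : ℝ :=
  Filter.limsup (fun x : ℕ => (countBelow S x : ℝ) / x) Filter.atTop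

/-- `S` is an `M`-set: for all `a, b ∈ S`, the difference `a - b` does not lie in `M`. -/
def IsMSet (M S : Set ℕ) : Prop := ∀ a ∈ S, ∀ b ∈ S, a - b ∉ M

/-- Motzkin's quantity `μ(M)`: the supremum of the upper densities of all `M`-sets. -/
noncomputable def muM (M : Set ℕ) : ℝ :=
  sSup {x : ℝ | ∃ S : Set ℕ, IsMSet M S ∧ x = upperDensity S}

lemma countBelow_le (S : Set ℕ) (x : ℕ) : countBelow S x ≤ x + 1 := by
  have h := Set.ncard_le_ncard (Set.inter_subset_right (s := S)) (Set.finite_Iic x)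
  rwa [← Finset.coe_Iic, Set.ncard_coe_finset, Nat.card_Iic, Finset.coe_Iic] at h

lemma countBelow_div_le (S : Set ℕ) (x : ℕ) : (countBelow S x : ℝ) / x ≤ 2 := by
  rcases Nat.eq_zero_or_pos x with rfl | hx
  · simp
  · rw [div_le_iff₀ (by exact_mod_cast hx)]
    have h := countBelow_le S x
    exact_mod_cast (by omega : countBelow S x ≤ 2 * x)

lemma countBelow_div_nonneg (S : Set ℕ) (x : ℕ) : 0 ≤ (countBelow S x : ℝ) / x := by
  positivity

lemma isCobounded_countBelow_div (S : Set ℕ) :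
    IsCoboundedUnder (· ≤ ·) atTop fun x : ℕ => (countBelow S x : ℝ) / x :=
  isCoboundedUnder_le_of_le atTop (countBelow_div_nonneg S)

lemma upperDensity_le_two (S : Set ℕ) : upperDensity S ≤ 2 :=
  limsup_le_of_le (isCobounded_countBelow_div S) (.of_forall (countBelow_div_le S))

lemma eventually_countBelow_le {S : Set ℕ} {c : ℝ} (h : upperDensity S < c) :
    ∀ᶠ x : ℕ in atTop, (countBelow S x : ℝ) ≤ c * x := by
  have hb : IsBoundedUnder (· ≤ ·) atTop fun x : ℕ => (countBelow S x : ℝ) / x :=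
    isBoundedUnder_of ⟨2, countBelow_div_le S⟩
  filter_upwards [eventually_lt_of_limsup_lt h hb, eventually_gt_atTop 0] with x hx hx0
  exact (div_le_iff₀ (by exact_mod_cast hx0)).1 hx.le

lemma upperDensity_le_of_eventually {S : Set ℕ} {c : ℝ}
    (h : ∀ ε > 0, ∀ᶠ x : ℕ in atTop, (countBelow S x : ℝ) ≤ (c + ε) * x) :
    upperDensity S ≤ c := by
  refine le_of_forall_pos_le_add fun ε hε => ?_
  refine limsup_le_of_le (isCobounded_countBelow_div S) ?_
  filter_upwards [h ε hε, eventually_gt_atTop 0] with x hx hx0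
  exact (div_le_iff₀ (by exact_mod_cast hx0)).2 hx

lemma upperDensity_le_muM {M S : Set ℕ} (h : IsMSet M S) : upperDensity S ≤ muM M :=
  le_csSup ⟨2, by rintro _ ⟨T, -, rfl⟩; exact upperDensity_le_two T⟩ ⟨S, h, rfl⟩

lemma muM_le {M : Set ℕ} {c : ℝ} (h : ∀ S, IsMSet M S → upperDensity S ≤ c) : muM M ≤ c :=
  csSup_le ⟨_, ∅, by simp [IsMSet], rfl⟩ (by rintro _ ⟨S, hS, rfl⟩; exact h S hS)

/-- Blowing up every point of `S` to a block of length `d` multiplies the count by `d`. -/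
lemma mul_countBelow_le_countBelow_preimage_div (S : Set ℕ) {d : ℕ} (hd : 0 < d) (x : ℕ) :
    d * countBelow S x ≤ countBelow {n | n / d ∈ S} (d * (x + 1)) := by
  have hcard : ((S ∩ Set.Iic x) ×ˢ ((Finset.range d : Finset ℕ) : Set ℕ)).ncard
      = d * countBelow S x := by
    rw [Set.ncard_prod, Set.ncard_coe_finset, Finset.card_range, mul_comm, countBelow]
  have key (p : ℕ × ℕ) (hp : p.2 < d) : (d * p.1 + p.2) / d = p.1 := by
    rw [Nat.mul_add_div hd, Nat.div_eq_of_lt hp, add_zero]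
  rw [← hcard, countBelow]
  refine Set.ncard_le_ncard_of_injOn (fun p => d * p.1 + p.2) ?_ ?_
    ((Set.finite_Iic _).inter_of_right _)
  · rintro p ⟨⟨hS, hx⟩, hr⟩
    have hr : p.2 < d := by simpa using hr
    have hx : p.1 ≤ x := hx
    refine ⟨by simpa [key p hr] using hS, ?_⟩
    have := Nat.mul_le_mul_left d hx
    change d * p.1 + p.2 ≤ d * (x + 1)
    rw [mul_add]
    omega
  · rintro p ⟨-, hp⟩ q ⟨-, hq⟩ h
    have hp : p.2 < d := by simpa using hp
    have hq : q.2 < d := by simpa using hq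
    have h : d * p.1 + p.2 = d * q.1 + q.2 := h
    have h1 : p.1 = q.1 := by rw [← key p hp, h, key q hq]
    rw [h1] at h
    exact Prod.ext h1 (by omega)

lemma countBelow_le_sum_residues (T : Set ℕ) {d : ℕ} (hd : 0 < d) (x : ℕ) :
    countBelow T x ≤ ∑ r ∈ Finset.range d, countBelow {s | d * s + r ∈ T} (x / d) := by
  have hsub : T ∩ Set.Iic x ⊆ ⋃ r ∈ Finset.range d,
      (fun s => d * s + r) '' ({s | d * s + r ∈ T} ∩ Set.Iic (x / d)) := by
    rintro n ⟨hn, hx⟩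
    simp only [Set.mem_iUnion, Finset.mem_range]
    refine ⟨n % d, Nat.mod_lt n hd, n / d, ⟨?_, Nat.div_le_div_right hx⟩, Nat.div_add_mod n d⟩
    simpa [Nat.div_add_mod] using hn
  have hfin (r : ℕ) : ({s | d * s + r ∈ T} ∩ Set.Iic (x / d)).Finite :=
    (Set.finite_Iic _).inter_of_right _
  calc countBelow T x
      ≤ _ := Set.ncard_le_ncard hsub
        ((Finset.range d).finite_toSet.biUnion fun r _ => (hfin r).image _)
    _ ≤ ∑ r ∈ Finset.range d,
        ((fun s => d * s + r) '' ({s | d * s + r ∈ T} ∩ Set.Iic (x / d))).ncard :=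
        Finset.set_ncard_biUnion_le _ _
    _ ≤ _ := Finset.sum_le_sum fun r _ => Set.ncard_image_le (hfin r)

lemma upperDensity_le_upperDensity_preimage_div (S : Set ℕ) {d : ℕ} (hd : 0 < d) :
    upperDensity S ≤ upperDensity {n | n / d ∈ S} := by
  refine upperDensity_le_of_eventually fun ε hε => ?_
  set c := upperDensity {n | n / d ∈ S} + ε / 2 with hc
  have htend : Tendsto (fun x : ℕ => d * (x + 1)) atTop atTop :=
    tendsto_atTop_mono (fun x => (Nat.le_succ x).trans (Nat.le_mul_of_pos_left _ hd)) tendsto_id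
  obtain ⟨N, hN⟩ := exists_nat_gt (c / (ε / 2))
  filter_upwards [htend.eventually (eventually_countBelow_le (by linarith : _ < c)),
    eventually_ge_atTop N] with x hx hxN
  have hd' : (0 : ℝ) < d := by exact_mod_cast hd
  have h1 : (d : ℝ) * countBelow S x ≤ c * (d * (x + 1)) := by
    refine le_trans ?_ (by simpa using hx)
    exact_mod_cast mul_countBelow_le_countBelow_preimage_div S hd x
  have h2 : (countBelow S x : ℝ) ≤ c * (x + 1) :=
    le_of_mul_le_mul_left (by linarith) hd'
  have h3 : c ≤ ε / 2 * x := by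
    rw [div_lt_iff₀ (by positivity)] at hN
    have : (N : ℝ) ≤ x := by exact_mod_cast hxN
    nlinarith
  nlinarith

lemma upperDensity_le_of_residues {T : Set ℕ} {d : ℕ} (hd : 0 < d) {c : ℝ}
    (h : ∀ r, upperDensity {s | d * s + r ∈ T} ≤ c) : upperDensity T ≤ c := by
  refine upperDensity_le_of_eventually fun ε hε => ?_
  have hall : ∀ᶠ y : ℕ in atTop, ∀ r ∈ Finset.range d,
      (countBelow {s | d * s + r ∈ T} y : ℝ) ≤ (c + ε) * y :=
    (Filter.eventually_all_finset _).2 fun r _ =>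
      eventually_countBelow_le (by linarith [h r])
  filter_upwards [(Nat.tendsto_div_const_atTop hd.ne').eventually hall,
    eventually_ge_atTop d] with x hx hxd
  have hq : (0 : ℝ) < (x / d : ℕ) := by exact_mod_cast Nat.div_pos hxd hd
  have hcε : 0 ≤ c + ε :=
    nonneg_of_mul_nonneg_left ((Nat.cast_nonneg _).trans (hx 0 (Finset.mem_range.2 hd))) hq
  calc (countBelow T x : ℝ)
      ≤ ∑ r ∈ Finset.range d, (countBelow {s | d * s + r ∈ T} (x / d) : ℝ) := by
        exact_mod_cast countBelow_le_sum_residues T hd x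
    _ ≤ ∑ r ∈ Finset.range d, (c + ε) * (x / d : ℕ) := Finset.sum_le_sum hx
    _ = (c + ε) * (d * (x / d : ℕ) : ℝ) := by
        rw [Finset.sum_const, Finset.card_range, nsmul_eq_mul]; ring
    _ ≤ (c + ε) * x :=
        mul_le_mul_of_nonneg_left (by exact_mod_cast Nat.mul_div_le x d) hcε

/-- Theorem A (Cantor–Gordon): If `M₂ = d·M₁` for a positive integer `d`, then
`μ(M₁) = μ(M₂)`. -/
theorem stmt15 (M₁ : Set ℕ) (hpos : ∀ k ∈ M₁, 0 < k)
    (d : ℕ) (hd : 0 < d)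
    (M₂ : Set ℕ) (hM₂ : M₂ = (fun k => d * k) '' M₁) :
    muM M₁ = muM M₂ := by
  subst hM₂
  refine le_antisymm (muM_le fun S hS => ?_) (muM_le fun T hT => ?_)
  · refine (upperDensity_le_upperDensity_preimage_div S hd).trans (upperDensity_le_muM ?_)
    rintro a ha b hb ⟨m, hm, hab⟩
    have hab : d * m = a - b := hab
    have hdm : 0 < d * m := Nat.mul_pos hd (hpos m hm)
    have ha' : a / d = b / d + m := by
      rw [show a = b + d * m by omega, Nat.add_mul_div_left _ _ hd]
    refine hS _ ha _ hb ?_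
    rwa [ha', Nat.add_sub_cancel_left]
  · refine upperDensity_le_of_residues hd fun r => upperDensity_le_muM ?_
    intro a ha b hb hab
    refine hT _ ha _ hb ⟨a - b, hab, ?_⟩
    rw [Nat.add_sub_add_right]
    exact Nat.mul_sub d a b
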